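/- arXiv:2503.24264 — 2 statements merged into one kernel-verified Lean document; each statement's English description precedes it below -/
import Mathlib

section
/- If x₊, y₊ ∈ V₊ are such that the element (x₊, φ(y₊)) of H ⊕ H' belongs to L₋ + L₀, then x₊ + y₊ ∈ V₋ ∩ V₊. -/
/-- A form `B : E → E → ℂ` is sesquilinear: additive in each variable,
conjugate-linear in the first variable and linear in the second. -/
def IsSesquilinear {E : Type*} [AddCommGroup E] [Module ℂ E] (B : E → E → ℂ) : Prop :=
  (∀ x y z, B (x + y) z = B x z + B y z) ∧
  (∀ (c : ℂ) (x y), B (c • x) y = (starRingEnd ℂ) c * B x y) ∧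
  (∀ x y z, B x (y + z) = B x y + B x z) ∧
  (∀ (c : ℂ) (x y), B x (c • y) = c * B x y)

/-- `B` is skew-Hermitian: `B y x = -conj (B x y)`. -/
def IsSkewHermitian {E : Type*} (B : E → E → ℂ) : Prop :=
  ∀ x y, B y x = -(starRingEnd ℂ) (B x y)

/-- `B` is non-degenerate: `B x y = 0` for all `y` implies `x = 0`. -/
def IsNondegenerate {E : Type*} [Zero E] (B : E → E → ℂ) : Prop :=
  ∀ x, (∀ y, B x y = 0) → x = 0

/-- A subspace `V` is Lagrangian with respect to the form `B` if `B` vanishes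
identically on `V × V` and `2 ⬝ dim V` equals the dimension of the ambient space. -/
def IsLagrangian {E : Type*} [AddCommGroup E] [Module ℂ E]
    (B : E → E → ℂ) (V : Submodule ℂ E) : Prop :=
  (∀ x ∈ V, ∀ y ∈ V, B x y = 0) ∧ 2 * Module.finrank ℂ V = Module.finrank ℂ E


/-- If `x₊, y₊ ∈ V₊` are such that `(x₊, φ(y₊)) ∈ L₋ + L₀`, then `x₊ + y₊ ∈ V₋ ∩ V₊`. -/
theorem mem_inf_of_mem_sup
    {H H' : Type*} [AddCommGroup H] [Module ℂ H] [FiniteDimensional ℂ H]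
    [AddCommGroup H'] [Module ℂ H'] [FiniteDimensional ℂ H']
    (B : H → H → ℂ) (B' : H' → H' → ℂ)
    (hB : IsSesquilinear B) (hB' : IsSesquilinear B')
    (hBskew : IsSkewHermitian B) (hB'skew : IsSkewHermitian B')
    (hBnd : IsNondegenerate B) (hB'nd : IsNondegenerate B')
    (φ : H ≃ₗ[ℂ] H') (hφ : ∀ x y, B' (φ x) (φ y) = B x y)
    (Vneg Vpos : Submodule ℂ H)
    (hVneg : IsLagrangian B Vneg) (hVpos : IsLagrangian B Vpos)
    -- `L₋ = {(v, φ(w)) : v, w ∈ V₋}` and `L₀ = {(x, -φ(x)) : x ∈ H}`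
    (Lneg L0 : Submodule ℂ (H × H'))
    (hLneg : Lneg = Vneg.prod (Vneg.map (φ : H →ₗ[ℂ] H')))
    (hL0 : L0 = LinearMap.graph (-(φ : H →ₗ[ℂ] H')))
    (xpos ypos : H) (hx : xpos ∈ Vpos) (hy : ypos ∈ Vpos)
    (hmem : (xpos, φ ypos) ∈ Lneg ⊔ L0) :
    xpos + ypos ∈ Vneg ⊓ Vpos := by
  subst hLneg hL0
  obtain ⟨⟨v, _⟩, ⟨hv, w, hw, rfl⟩, ⟨z, z'⟩, hz, h⟩ := Submodule.mem_sup.mp hmem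
  replace hz : z' = -φ z := hz
  subst hz
  obtain ⟨hxz, hyz⟩ := Prod.mk.inj h
  have hyz' : w - z = ypos := φ.injective (by simpa [sub_eq_add_neg] using hyz)
  have hsum : xpos + ypos = v + w := by
    rw [← hxz, ← hyz']
    abel
  exact ⟨hsum ▸ Vneg.add_mem hv hw, Vpos.add_mem hx hy⟩
end

section
/- For all a, b ∈ (L₋ + L₀) ∩ L₊ and every decomposition a = a₋ + a₀ with a₋ ∈ L₋ and a₀ ∈ L₀, one has a₀ • b = 0. In particular, the Hermitian form f on (L₋ + L₀) ∩ L₊ defined by f(a,b) = a₀ • b is identically zero, and hence the Maslov index Maslov(L₋, L₀, L₊), defined as the signature of f, vanishes. -/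
/-- For all `a, b ∈ (L₋ + L₀) ∩ L₊` and every decomposition `a = a₋ + a₀` with
`a₋ ∈ L₋` and `a₀ ∈ L₀`, one has `a₀ • b = 0`; i.e. the Hermitian form `f` computing
the Maslov index `Maslov(L₋, L₀, L₊)` is identically zero, so this Maslov index
(the signature of `f`) vanishes. -/
theorem maslov_form_eq_zero
    {H H' : Type*} [AddCommGroup H] [Module ℂ H] [FiniteDimensional ℂ H]
    [AddCommGroup H'] [Module ℂ H'] [FiniteDimensional ℂ H']
    (B : H → H → ℂ) (B' : H' → H' → ℂ)
    (hB : IsSesquilinear B) (hB' : IsSesquilinear B')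
    (hBskew : IsSkewHermitian B) (hB'skew : IsSkewHermitian B')
    (hBnd : IsNondegenerate B) (hB'nd : IsNondegenerate B')
    (φ : H ≃ₗ[ℂ] H') (hφ : ∀ x y, B' (φ x) (φ y) = B x y)
    (Vneg Vpos : Submodule ℂ H)
    (hVneg : IsLagrangian B Vneg) (hVpos : IsLagrangian B Vpos)
    -- `L₋ = {(v, φ(w)) : v, w ∈ V₋}`, `L₀ = {(x, -φ(x)) : x ∈ H}`,
    -- `L₊ = {(v, φ(w)) : v, w ∈ V₊}`
    (Lneg L0 Lpos : Submodule ℂ (H × H'))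
    (hLneg : Lneg = Vneg.prod (Vneg.map (φ : H →ₗ[ℂ] H')))
    (hL0 : L0 = LinearMap.graph (-(φ : H →ₗ[ℂ] H')))
    (hLpos : Lpos = Vpos.prod (Vpos.map (φ : H →ₗ[ℂ] H'))) :
    ∀ a b : H × H', a ∈ (Lneg ⊔ L0) ⊓ Lpos → b ∈ (Lneg ⊔ L0) ⊓ Lpos →
      ∀ aneg a0 : H × H', aneg ∈ Lneg → a0 ∈ L0 → a = aneg + a0 →
        B a0.1 b.1 - B' a0.2 b.2 = 0 := by
  obtain ⟨hadd_left, hsmul_left, hadd_right, -⟩ := hB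
  subst hLneg hL0 hLpos
  rintro ⟨p, q'⟩ ⟨r, s'⟩ ⟨-, hp, -⟩ ⟨hb, hr, hs⟩ ⟨v, w'⟩ ⟨x, x'⟩ ⟨hv, -⟩ hx ha
  obtain ⟨s, hs, rfl⟩ := hs
  obtain ⟨⟨v₁, w₁'⟩, ⟨hv₁, w₁, hw₁, hw₁'⟩, ⟨y, y'⟩, hy, hsum⟩ := Submodule.mem_sup.1 hb
  simp only [LinearMap.mem_graph_iff, LinearMap.neg_apply, LinearEquiv.coe_coe, Prod.mk_add_mk,
    Prod.mk.injEq] at *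
  obtain ⟨hpv, -⟩ := ha
  obtain ⟨hr', hs'⟩ := hsum
  subst hx hy hw₁'
  have hs_eq : s = w₁ - y := φ.injective (by rw [← hs', map_sub, sub_eq_add_neg])
  have hneg : B (-x) s = -B x s := by simpa using hsmul_left (-1) x s
  have hmem : r + s ∈ Vneg := by
    have h : r + s = v₁ + w₁ := by rw [← hr', hs_eq]; abel
    exact h ▸ Vneg.add_mem hv₁ hw₁
  have hp0 : B p (r + s) = 0 := hVpos.1 p hp _ (Vpos.add_mem hr hs)
  have hv0 : B v (r + s) = 0 := hVneg.1 v hv _ hmem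
  rw [hpv, hadd_left, hv0, zero_add, hadd_right] at hp0
  rw [← map_neg, hφ, hneg, sub_neg_eq_add, hp0]
end
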